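/- arXiv:2206.09098 — 2 statements merged into one kernel-verified Lean document; each statement's English description precedes it below -/
import Mathlib

section
/- Let ℚ be a finite positive Borel measure on ℝ^d and f : ℝ^d → ℝ ∪ {∞} a Borel measurable function. Then ∫ S_ε(f) dℚ = sup over Borel measures ℚ' with W_∞(ℚ, ℚ') ≤ ε of ∫ f dℚ', where the left integral is taken with respect to the completion of ℚ. -/
open MeasureTheory
open scoped ENNReal

/-- The nonnegative part of an extended real, in `ℝ≥0∞`. -/
noncomputable def erealToENNReal (e : EReal) : ℝ≥0∞ :=
  if e = ⊤ then ⊤ else ENNReal.ofReal e.toReal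

/-- The ∞-Wasserstein distance: infimum over couplings of the essential supremum of the
distance. -/
noncomputable def Winf {E : Type*} [NormedAddCommGroup E] [MeasurableSpace E]
    (P Q : Measure E) : ℝ≥0∞ :=
  ⨅ (γ : Measure (E × E)) (_ : γ.map Prod.fst = P ∧ γ.map Prod.snd = Q),
    essSup (fun p => (‖p.1 - p.2‖₊ : ℝ≥0∞)) γ

/-- Integral of an `EReal`-valued function, as the difference of the lower integrals of the
positive and negative parts. -/
noncomputable def erealIntegral {E : Type*} [MeasurableSpace E] (μ : Measure E)
    (f : E → EReal) : EReal :=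
  ((∫⁻ x, erealToENNReal (f x) ∂μ : ℝ≥0∞) : EReal) -
    ((∫⁻ x, erealToENNReal (-(f x)) ∂μ : ℝ≥0∞) : EReal)


section aux
open Set Filter Topology Metric

/-- closed `ε`-neighbourhood, as a union of closed balls -/
def nbd {E : Type*} [PseudoMetricSpace E] (ε : ℝ) (A : Set E) : Set E := {x | ∃ y ∈ A, dist x y ≤ ε}

theorem nbd_mono {E : Type*} [PseudoMetricSpace E] {ε : ℝ} {A B : Set E} (h : A ⊆ B) :
    nbd ε A ⊆ nbd ε B := fun _ ⟨y, hy, hd⟩ => ⟨y, h hy, hd⟩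

theorem nbd_compact {E : Type*} [PseudoMetricSpace E] {ε : ℝ} (hε : 0 ≤ ε) {K : Set E}
    (hK : IsCompact K) : nbd ε K = cthickening ε K := by
  rw [hK.cthickening_eq_biUnion_closedBall hε]
  ext x; simp [nbd]

theorem nbd_iUnion {E ι : Type*} [PseudoMetricSpace E] {ε : ℝ} {A : ι → Set E} :
    nbd ε (⋃ i, A i) = ⋃ i, nbd ε (A i) := by
  ext x; simp only [nbd, mem_iUnion, mem_ofPred_eq]
  constructor
  · rintro ⟨y, ⟨i, hi⟩, h⟩; exact ⟨i, y, hi, h⟩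
  · rintro ⟨i, y, hi, h⟩; exact ⟨y, ⟨i, hi⟩, h⟩

theorem box_compact (n : ℕ → ℕ) : IsCompact {σ : ℕ → ℕ | ∀ i, σ i ≤ n i} := by
  have : {σ : ℕ → ℕ | ∀ i, σ i ≤ n i} = Set.pi univ (fun i => Set.Iic (n i)) := by
    ext; simp only [Set.mem_pi, mem_univ, mem_Iic, true_imp_iff, mem_ofPred_eq]
  rw [this]
  exact isCompact_univ_pi (fun i => (Set.finite_Iic _).isCompact)

theorem box_nhds (n : ℕ → ℕ) (V : Set (ℕ → ℕ)) (hV : IsOpen V)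
    (h : {σ : ℕ → ℕ | ∀ i, σ i ≤ n i} ⊆ V) :
    ∃ k, {σ : ℕ → ℕ | ∀ i < k, σ i ≤ n i} ⊆ V := by
  by_contra! hc
  simp only [not_subset] at hc
  choose σ hσ hσV using hc
  have hmem : ∀ k, (fun i => min (σ k i) (n i)) ∈ {σ : ℕ → ℕ | ∀ i, σ i ≤ n i} :=
    fun k i => min_le_right _ _
  obtain ⟨τ, hτ, φ, hφ, ht⟩ := (box_compact n).tendsto_subseq hmem
  have ht2 : Tendsto (fun k => σ (φ k)) atTop (𝓝 τ) := by
    rw [tendsto_pi_nhds] at ht ⊢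
    intro i
    refine (ht i).congr' ?_
    filter_upwards [eventually_gt_atTop i] with k hk
    have : i < φ k := lt_of_lt_of_le hk (hφ.id_le k)
    exact min_eq_left (hσ _ i this)
  have := ht2.eventually (hV.mem_nhds (h hτ))
  obtain ⟨k, hk⟩ := this.exists
  exact hσV _ hk

theorem capacity {E : Type*} [NormedAddCommGroup E] [ProperSpace E] [MeasurableSpace E] [BorelSpace E]
    (Q : Measure E) [IsFiniteMeasure Q] {ε : ℝ} (hε : 0 ≤ ε) {A : Set E} (hA : MeasurableSet A)
    {c : ℝ≥0∞} (hc : c < Q (nbd ε A)) :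
    ∃ K ⊆ A, IsCompact K ∧ c ≤ Q (nbd ε K) := by
  have hA' := hA.analyticSet
  rw [AnalyticSet] at hA'
  rcases hA' with rfl | ⟨p, hp, rfl⟩
  · simp [nbd] at hc
  have step : ∀ (S : Set (ℕ → ℕ)) (i : ℕ), c < Q (nbd ε (p '' S)) →
      ∃ m, c < Q (nbd ε (p '' (S ∩ {σ | σ i ≤ m}))) := by
    intro S i h
    have e : nbd ε (p '' S) = ⋃ m : ℕ, nbd ε (p '' (S ∩ {σ | σ i ≤ m})) := by
      rw [← nbd_iUnion, ← image_iUnion, ← inter_iUnion]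
      congr 2
      symm
      rw [inter_eq_left]
      intro σ _
      simp only [mem_iUnion, mem_ofPred_eq]
      exact ⟨σ i, le_rfl⟩
    rw [e, Monotone.measure_iUnion] at h
    · exact lt_iSup_iff.1 h
    · intro a b hab
      exact nbd_mono (image_mono (inter_subset_inter_right _ (fun σ hσ => le_trans hσ hab)))
  choose! m hm using step
  let S : ℕ → Set (ℕ → ℕ) := fun k => Nat.rec univ (fun k S => S ∩ {σ | σ k ≤ m S k}) k
  have hS0 : S 0 = univ := rfl
  have hS1 : ∀ k, S (k+1) = S k ∩ {σ | σ k ≤ m (S k) k} := fun k => rfl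
  have hSc : ∀ k, c < Q (nbd ε (p '' (S k))) := by
    intro k
    induction k with
    | zero => rw [hS0, image_univ]; exact hc
    | succ k ih => rw [hS1]; exact hm _ _ ih
  set n : ℕ → ℕ := fun k => m (S k) k with hn
  have hSn : ∀ k, S k = {σ | ∀ i < k, σ i ≤ n i} := by
    intro k
    induction k with
    | zero => rw [hS0]; ext; simp
    | succ k ih =>
      rw [hS1]; nth_rewrite 1 [ih]
      ext σ
      simp only [mem_inter_iff, mem_ofPred_eq, Nat.lt_succ_iff_lt_or_eq, hn]
      constructor
      · rintro ⟨h1, h2⟩ i (hi | rfl)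
        · exact h1 i hi
        · exact h2
      · intro h
        exact ⟨fun i hi => h i (Or.inl hi), h k (Or.inr rfl)⟩
  set K := p '' {σ : ℕ → ℕ | ∀ i, σ i ≤ n i} with hKdef
  have hK : IsCompact K := (box_compact n).image hp
  refine ⟨K, image_subset_range _ _, hK, ?_⟩
  have hKc : IsCompact (nbd ε K) := by rw [nbd_compact hε hK]; exact hK.cthickening
  rw [(nbd ε K).measure_eq_iInf_isOpen Q]
  refine le_iInf fun U => le_iInf fun hU => le_iInf fun hUo => ?_
  obtain ⟨δ, hδ, hδU⟩ := hKc.exists_thickening_subset_open hUo hU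
  -- the open neighbourhood of K whose ε-neighbourhood is in U
  have hex : ∃ V, IsOpen V ∧ K ⊆ V ∧ nbd ε V ⊆ U := by
    refine ⟨thickening δ K, isOpen_thickening, self_subset_thickening hδ K, ?_⟩
    rintro x ⟨v, hv, hxv⟩
    obtain ⟨y, hy, hvy⟩ := mem_thickening_iff.1 hv
    refine hδU (mem_thickening_iff.2 ⟨y + (x - v), ⟨y, hy, ?_⟩, ?_⟩)
    · rw [dist_eq_norm] at hxv ⊢
      simpa using hxv
    · rw [dist_eq_norm] at hvy ⊢
      convert hvy using 2
      abel
  obtain ⟨V, hVo, hKV, hVU⟩ := hex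
  obtain ⟨k, hk⟩ := box_nhds n (p ⁻¹' V) (hVo.preimage hp) (fun σ hσ => hKV ⟨σ, hσ, rfl⟩)
  rw [← hSn] at hk
  exact (hSc k).le.trans (measure_mono ((nbd_mono (image_subset_iff.2 hk)).trans hVU))

theorem nbd_ae {E : Type*} [NormedAddCommGroup E] [ProperSpace E] [MeasurableSpace E] [BorelSpace E]
    (Q : Measure E) [IsFiniteMeasure Q] {ε : ℝ} (hε : 0 ≤ ε) {A : Set E} (hA : MeasurableSet A) :
    ∃ K : ℕ → Set E, (∀ n, K n ⊆ A) ∧ (∀ n, IsCompact (K n)) ∧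
      Q (nbd ε A \ ⋃ n, nbd ε (K n)) = 0 := by
  by_cases h0 : Q (nbd ε A) = 0
  · exact ⟨fun _ => ∅, by simp, by simp, measure_mono_null sdiff_subset h0⟩
  obtain ⟨u, -, hu, hlim⟩ := exists_seq_strictMono_tendsto' (pos_iff_ne_zero.2 h0)
  have : ∀ n, ∃ K ⊆ A, IsCompact K ∧ u n ≤ Q (nbd ε K) :=
    fun n => capacity Q hε hA (hu n).2
  choose K hKA hKc hKu using this
  refine ⟨K, hKA, hKc, ?_⟩
  have hmeas : MeasurableSet (⋃ n, nbd ε (K n)) := MeasurableSet.iUnion fun n => by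
    rw [nbd_compact hε (hKc n)]; exact isClosed_cthickening.measurableSet
  rw [measure_sdiff (iUnion_subset fun n => nbd_mono (hKA n)) hmeas.nullMeasurableSet
    (measure_ne_top _ _)]
  rw [tsub_eq_zero_iff_le]
  refine le_of_tendsto' hlim fun n => (hKu n).trans (measure_mono (subset_iUnion (fun n => nbd ε (K n)) n))

theorem nbd_null {E : Type*} [NormedAddCommGroup E] [ProperSpace E] [MeasurableSpace E] [BorelSpace E]
    (Q : Measure E) [IsFiniteMeasure Q] {ε : ℝ} (hε : 0 ≤ ε) {A : Set E} (hA : MeasurableSet A) :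
    NullMeasurableSet (nbd ε A) Q := by
  obtain ⟨K, hKA, hKc, h⟩ := nbd_ae Q hε hA
  have hmeas : MeasurableSet (⋃ n, nbd ε (K n)) := MeasurableSet.iUnion fun n => by
    rw [nbd_compact hε (hKc n)]; exact isClosed_cthickening.measurableSet
  have e : nbd ε A = (⋃ n, nbd ε (K n)) ∪ (nbd ε A \ ⋃ n, nbd ε (K n)) :=
    (union_sdiff_cancel (iUnion_subset fun n => nbd_mono (hKA n))).symm
  rw [e]
  exact hmeas.nullMeasurableSet.union (NullMeasurableSet.of_null h)

/-- measurable selection for a compact set -/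
theorem sel_compact {E : Type*} [MetricSpace E] [ProperSpace E] [MeasurableSpace E] [BorelSpace E]
    {ε : ℝ} (hε : 0 ≤ ε) {K : Set E} (hK : IsCompact K) :
    ∃ T : E → E, Measurable T ∧ ∀ x ∈ nbd ε K, T x ∈ K ∧ dist x (T x) ≤ ε := by
  rcases isEmpty_or_nonempty E with hE | hE
  · exact ⟨id, measurable_id, fun x => (hE.false x).elim⟩
  set d := TopologicalSpace.denseSeq E
  have hd : ∀ (y : E) (r : ℝ), 0 < r → ∃ j, dist y (d j) ≤ r := by
    intro y r hr
    obtain ⟨j, hj⟩ := (TopologicalSpace.denseRange_denseSeq E).exists_dist_lt y hr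
    exact ⟨j, hj.le⟩
  have hmeas : ∀ (z : E) (r : ℝ), MeasurableSet (nbd ε (K ∩ closedBall z r)) := by
    intro z r
    rw [nbd_compact hε (hK.inter_right isClosed_closedBall)]
    exact isClosed_cthickening.measurableSet
  have hmeas0 : MeasurableSet (nbd ε K) := by
    rw [nbd_compact hε hK]
    exact isClosed_cthickening.measurableSet
  have step : ∀ (r r' : ℝ), 0 < r' → ∀ T : E → E, Measurable T →
      ∃ T' : E → E, Measurable T' ∧ ∀ x ∈ nbd ε K, x ∈ nbd ε (K ∩ closedBall (T x) r) →
        dist (T' x) (T x) ≤ r + r' ∧ x ∈ nbd ε (K ∩ closedBall (T' x) r') := by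
    intro r r' hr' T hT
    let R : ℕ → E → Prop := fun j x => (dist (d j) (T x) ≤ r + r' ∧ x ∈ nbd ε (K ∩ closedBall (d j) r'))
    let P : ℕ → E → Prop := fun j x => (¬ ∃ i, R i x) ∨ R j x
    have hRm : ∀ j, MeasurableSet {x | R j x} := by
      intro j
      exact (measurableSet_le (measurable_const.dist hT) measurable_const).inter (hmeas _ _)
    have hPm : ∀ j, MeasurableSet {x | P j x} := by
      intro j
      refine MeasurableSet.union ?_ (hRm j)
      refine MeasurableSet.compl ?_
      have : {x | ∃ i, R i x} = ⋃ i, {x | R i x} := by ext; simp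
      have h2 := MeasurableSet.iUnion hRm
      rw [← this] at h2
      exact h2
    have hP : ∀ x, ∃ j, P j x := by
      intro x
      by_cases h : ∃ i, R i x
      · obtain ⟨i, hi⟩ := h; exact ⟨i, Or.inr hi⟩
      · exact ⟨0, Or.inl h⟩
    classical
    refine ⟨fun x => d (Nat.find (hP x)), Measurable.find (f := fun j _ => d j) (fun j => measurable_const) hPm hP, ?_⟩
    intro x hx ⟨y, hy, hxy⟩
    have hex : ∃ i, R i x := by
      obtain ⟨j, hj⟩ := hd y r' hr'
      refine ⟨j, ?_, y, ⟨hy.1, hj⟩, hxy⟩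
      have := dist_triangle_left (d j) (T x) y
      have h2 : dist y (T x) ≤ r := hy.2
      linarith
    rcases Nat.find_spec (hP x) with h | h
    · exact (h hex).elim
    · exact h
  obtain ⟨z⟩ := hE
  obtain ⟨R, hR, hKR⟩ := hK.isBounded.subset_closedBall_lt 0 z
  have step' : ∀ (n : ℕ) (T : {T : E → E // Measurable T}), ∃ T' : {T : E → E // Measurable T},
      ∀ x ∈ nbd ε K, x ∈ nbd ε (K ∩ closedBall (T.1 x) (R * (1/2)^n)) →
        dist (T'.1 x) (T.1 x) ≤ R * (1/2)^n + R * (1/2)^(n+1) ∧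
          x ∈ nbd ε (K ∩ closedBall (T'.1 x) (R * (1/2)^(n+1))) := by
    intro n T
    obtain ⟨T', h1, h2⟩ := step (R * (1/2)^n) (R * (1/2)^(n+1)) (by positivity) T.1 T.2
    exact ⟨⟨T', h1⟩, h2⟩
  choose F hF using step'
  let S : ℕ → {T : E → E // Measurable T} := fun k => Nat.rec ⟨fun _ => z, measurable_const⟩ F k
  have hS0 : S 0 = ⟨fun _ => z, measurable_const⟩ := rfl
  have hS1 : ∀ k, S (k+1) = F k (S k) := fun k => rfl
  have hmem : ∀ x ∈ nbd ε K, ∀ n, x ∈ nbd ε (K ∩ closedBall ((S n).1 x) (R * (1/2)^n)) := by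
    intro x hx n
    induction n with
    | zero =>
      rw [hS0]
      obtain ⟨y, hy, h⟩ := hx
      refine ⟨y, ⟨hy, ?_⟩, h⟩
      simpa using hKR hy
    | succ n ih => rw [hS1]; exact (hF n (S n) x hx ih).2
  have hdist : ∀ x ∈ nbd ε K, ∀ n, dist ((S n).1 x) ((S (n+1)).1 x) ≤ 2 * R * (1/2)^n := by
    intro x hx n
    have := (hF n (S n) x hx (hmem x hx n)).1
    rw [dist_comm, hS1]
    rw [pow_succ] at this
    have h3 : 0 < R * (1/2)^n := by positivity
    linarith
  classical
  have hlim : ∀ x, ∃ y, (x ∈ nbd ε K → Tendsto (fun n => (S n).1 x) atTop (𝓝 y)) ∧ (x ∉ nbd ε K → y = z) := by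
    intro x
    by_cases hx : x ∈ nbd ε K
    · obtain ⟨y, hy⟩ := cauchySeq_tendsto_of_complete
        (cauchySeq_of_le_geometric (1/2) (2 * R) (by norm_num) (hdist x hx))
      exact ⟨y, fun _ => hy, fun h => (h hx).elim⟩
    · exact ⟨z, fun h => (hx h).elim, fun _ => rfl⟩
  choose T hT1 hT2 using hlim
  refine ⟨T, ?_, ?_⟩
  · refine measurable_of_tendsto_metrizable (f := fun n x => if x ∈ nbd ε K then (S n).1 x else z)
      (fun n => Measurable.ite hmeas0 (S n).2 measurable_const) ?_
    rw [tendsto_pi_nhds]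
    intro x
    by_cases hx : x ∈ nbd ε K
    · simpa [hx] using hT1 x hx
    · simp [hx, hT2 x hx]
  · intro x hx
    choose y hy hxy using hmem x hx
    have hr : Tendsto (fun n : ℕ => R * (1/2 : ℝ)^n) atTop (𝓝 0) := by
      have := (tendsto_pow_atTop_nhds_zero_of_lt_one (r := (1/2 : ℝ)) (by norm_num) (by norm_num)).const_mul R
      simpa using this
    have hyT : Tendsto y atTop (𝓝 (T x)) := by
      refine (tendsto_iff_of_dist ?_).1 (hT1 x hx)
      refine squeeze_zero (fun _ => dist_nonneg) (fun n => ?_) hr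
      rw [dist_comm]
      exact (hy n).2
    exact ⟨hK.isClosed.mem_of_tendsto hyT (Eventually.of_forall fun n => (hy n).1),
      le_of_tendsto' (tendsto_const_nhds.dist hyT) hxy⟩

end aux

section aux2
open Set Filter Topology Metric

theorem lt_toENNReal_iff {t : ℝ} (ht : 0 ≤ t) (e : EReal) :
    ENNReal.ofReal t < e.toENNReal ↔ (t : EReal) < e := by
  induction e with
  | bot => simp
  | top => simp
  | coe r => 
    rw [EReal.real_coe_toENNReal, EReal.coe_lt_coe_iff, ENNReal.ofReal_lt_ofReal_iff_of_nonneg ht]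

theorem hcake {δ : Type*} [MeasurableSpace δ] (ρ : Measure δ) (k : δ → ℝ≥0∞) (n : ℕ)
    (hk : AEMeasurable k ρ) : ∫⁻ x, min (k x) n ∂ρ =
        ∫⁻ t in Ioi (0:ℝ), ρ {a | t < (min (k a) n).toReal} := by
  rw [← lintegral_eq_lintegral_meas_lt ρ (Eventually.of_forall fun _ => ENNReal.toReal_nonneg)
    (hk.min aemeasurable_const).ennreal_toReal]
  refine lintegral_congr fun x => ?_
  rw [ENNReal.ofReal_toReal]
  exact ne_top_of_le_ne_top (ENNReal.natCast_ne_top n) (min_le_right _ _)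

theorem lintegral_dom {α β : Type*} [MeasurableSpace α] [MeasurableSpace β] (μ : Measure α)
    (ν : Measure β) {g : α → ℝ≥0∞} {h : β → ℝ≥0∞} (hg : AEMeasurable g μ) (hh : AEMeasurable h ν)
    (H : ∀ t : ℝ, 0 ≤ t → μ {x | ENNReal.ofReal t < g x} ≤ ν {x | ENNReal.ofReal t < h x}) :
    ∫⁻ x, g x ∂μ ≤ ∫⁻ x, h x ∂ν := by
  have e : ∀ x, g x = ⨆ n : ℕ, min (g x) n := by
    intro x
    rw [← inf_iSup_eq, ENNReal.iSup_natCast]; simp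
  have hmon : ∀ x, Monotone fun n : ℕ => min (g x) n := fun x a b hab =>
    min_le_min le_rfl (by exact_mod_cast hab)
  rw [lintegral_congr e, lintegral_iSup' (fun n => hg.min aemeasurable_const) (Eventually.of_forall hmon)]
  refine iSup_le fun n => ?_
  refine le_trans ?_ (lintegral_mono (fun x => min_le_left (h x) (n : ℝ≥0∞)))
  rw [hcake μ g n hg, hcake ν h n hh]
  refine setLIntegral_mono' measurableSet_Ioi fun t ht => ?_
  have ht0 : (0:ℝ) ≤ t := (mem_Ioi.1 ht).le
  have hne : ∀ a : ℝ≥0∞, min a n ≠ ⊤ := fun a =>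
    ne_top_of_le_ne_top (ENNReal.natCast_ne_top n) (min_le_right _ _)
  simp_rw [← ENNReal.ofReal_lt_iff_lt_toReal ht0 (hne _), lt_min_iff]
  by_cases hn : ENNReal.ofReal t < n
  · simpa [hn] using H t ht0
  · simp [hn]

variable {E : Type*} [NormedAddCommGroup E]

/-- the operator `S_ε` -/
noncomputable def SS (ε : ℝ) (f : E → EReal) (x : E) : EReal :=
  ⨆ h ∈ Metric.closedBall (0 : E) ε, f (x + h)

theorem lt_SS {ε : ℝ} {f : E → EReal} {a : EReal} :
    {x | a < SS ε f x} = nbd ε {y | a < f y} := by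
  ext x
  simp only [SS, nbd, lt_iSup_iff, mem_ofPred_eq]
  constructor
  · rintro ⟨h, hh, hl⟩
    exact ⟨x + h, hl, by simpa [dist_eq_norm] using hh⟩
  · rintro ⟨y, hy, hd⟩
    refine ⟨y - x, ?_, by simpa using hy⟩
    rw [dist_comm] at hd
    simpa [dist_eq_norm] using hd

theorem le_SS {ε : ℝ} {f : E → EReal} {x y : E} (h : dist x y ≤ ε) : f y ≤ SS ε f x := by
  unfold SS
  refine le_iSup₂_of_le (y - x) ?_ (by simp)
  rw [dist_comm] at h
  simpa [dist_eq_norm] using h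

variable [ProperSpace E] [MeasurableSpace E] [BorelSpace E]

theorem SS_aem (Q : Measure E) [IsFiniteMeasure Q] {ε : ℝ} (hε : 0 ≤ ε) {f : E → EReal}
    (hf : Measurable f) : AEMeasurable (SS ε f) Q := by
  apply NullMeasurable.aemeasurable
  have : @Measurable (NullMeasurableSpace E Q) EReal _ _ (SS (E := E) ε f) := by
    refine measurable_of_Ioi fun a => ?_
    have h := nbd_null Q hε (measurableSet_lt (measurable_const (a := a)) hf)
    rw [← lt_SS] at h
    exact h
  exact this

theorem winf_dom [NormedSpace ℝ E] (Q Q' : Measure E) [IsFiniteMeasure Q] {ε : ℝ} (hε : 0 ≤ ε)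
    (hW : Winf Q Q' ≤ ENNReal.ofReal ε) : Q' univ = Q univ ∧
      ∀ A, MeasurableSet A → Q' A ≤ Q (nbd ε A) := by
  have key : ∀ η : ℝ, 0 < η → ∃ γ : Measure (E × E), γ.map Prod.fst = Q ∧ γ.map Prod.snd = Q' ∧
      ∀ᵐ p ∂γ, dist p.1 p.2 ≤ ε + η := by
    intro η hη
    have : Winf Q Q' < ENNReal.ofReal (ε + η) :=
      hW.trans_lt ((ENNReal.ofReal_lt_ofReal_iff (by linarith)).2 (by linarith))
    unfold Winf at this
    simp only [iInf_lt_iff] at this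
    obtain ⟨γ, ⟨h1, h2⟩, h⟩ := this
    refine ⟨γ, h1, h2, ?_⟩
    filter_upwards [ae_lt_of_essSup_lt h] with p hp
    have h3 := hp.le
    rw [← enorm_eq_nnnorm, ← ofReal_norm, ENNReal.ofReal_le_ofReal_iff (by linarith)] at h3
    rwa [dist_eq_norm]
  have huniv : Q' univ = Q univ := by
    obtain ⟨γ, h1, h2, -⟩ := key 1 one_pos
    rw [← h1, ← h2, Measure.map_apply measurable_fst .univ, Measure.map_apply measurable_snd .univ]
    simp
  refine ⟨huniv, fun A hA => ?_⟩
  have : IsFiniteMeasure Q' := ⟨by rw [huniv]; exact measure_lt_top _ _⟩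
  rw [hA.measure_eq_iSup_isCompact_of_ne_top (measure_ne_top Q' A)]
  refine iSup_le fun K => iSup_le fun hKA => iSup_le fun hK => ?_
  refine le_trans ?_ (measure_mono (nbd_mono hKA))
  rw [nbd_compact hε hK]
  have hlim := tendsto_measure_cthickening_of_isCompact (μ := Q) (hK.cthickening (r := ε))
  have hlim2 : Tendsto (fun r => Q (cthickening r (cthickening ε K))) (𝓝[>] 0)
    (𝓝 (Q (cthickening ε K))) := hlim.mono_left nhdsWithin_le_nhds
  refine ge_of_tendsto hlim2 ?_
  filter_upwards [self_mem_nhdsWithin] with η hη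
  have hη : 0 < η := hη
  rw [cthickening_cthickening hη.le hε, add_comm]
  obtain ⟨γ, h1, h2, h3⟩ := key η hη
  rw [← h2, ← h1, Measure.map_apply measurable_fst isClosed_cthickening.measurableSet,
    Measure.map_apply measurable_snd hK.measurableSet]
  refine measure_mono_ae ?_
  filter_upwards [h3] with p hp hpK
  exact mem_cthickening_of_dist_le _ _ _ _ hpK hp

theorem le_dir [NormedSpace ℝ E] (Q Q' : Measure E) [IsFiniteMeasure Q] {ε : ℝ} (hε : 0 ≤ ε)
    {f : E → EReal} (hf : Measurable f)
    (hW : Winf Q Q' ≤ ENNReal.ofReal ε) : erealIntegral Q' f ≤ erealIntegral Q (SS ε f) := by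
  obtain ⟨hu, hdom⟩ := winf_dom Q Q' hε hW
  have : IsFiniteMeasure Q' := ⟨by rw [hu]; exact measure_lt_top _ _⟩
  have hF := SS_aem Q hε hf
  refine EReal.sub_le_sub ?_ ?_
  · rw [EReal.coe_ennreal_le_coe_ennreal_iff]
    refine lintegral_dom Q' Q hf.ereal_toENNReal.aemeasurable hF.ereal_toENNReal fun t ht => ?_
    have h := hdom _ (measurableSet_lt (measurable_const (a := (t:EReal))) hf)
    rw [← lt_SS] at h
    change Q' {x | ENNReal.ofReal t < (f x).toENNReal} ≤ Q {x | ENNReal.ofReal t < (SS ε f x).toENNReal}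
    simp only [lt_toENNReal_iff ht]
    exact h
  · rw [EReal.coe_ennreal_le_coe_ennreal_iff]
    refine lintegral_dom Q Q' hF.neg.ereal_toENNReal hf.neg.ereal_toENNReal.aemeasurable fun t ht => ?_
    change Q {x | ENNReal.ofReal t < (-(SS ε f x)).toENNReal} ≤
      Q' {x | ENNReal.ofReal t < (-(f x)).toENNReal}
    simp only [lt_toENNReal_iff ht]
    have hA : MeasurableSet {x | ((-t : ℝ) : EReal) ≤ f x} := measurableSet_le measurable_const hf
    have e1 : {x | (t:EReal) < - f x} = {x | ((-t : ℝ) : EReal) ≤ f x}ᶜ := by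
      ext x; simp [EReal.lt_neg_comm]
    have e2 : {x | (t:EReal) < - SS ε f x} = {x | ((-t : ℝ) : EReal) ≤ SS ε f x}ᶜ := by
      ext x; simp [EReal.lt_neg_comm]
    rw [e1, e2, measure_compl hA (measure_ne_top _ _),
      measure_compl₀ (nullMeasurableSet_le aemeasurable_const hF) (measure_ne_top _ _), hu]
    refine tsub_le_tsub_left ((hdom _ hA).trans (measure_mono ?_)) _
    rintro x ⟨y, hy, hd⟩
    exact le_trans hy (le_SS hd)

theorem meas_choice (R : ℕ → E → Prop) (hRm : ∀ j, MeasurableSet {x | R j x}) (T : ℕ → E → E)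
    (hT : ∀ j, Measurable (T j)) :
    ∃ T' : E → E, Measurable T' ∧ ∀ x, (∃ i, R i x) → ∃ i, R i x ∧ T' x = T i x := by
  let P : ℕ → E → Prop := fun j x => (¬ ∃ i, R i x) ∨ R j x
  have hPm : ∀ j, MeasurableSet {x | P j x} := by
    intro j
    refine MeasurableSet.union ?_ (hRm j)
    refine MeasurableSet.compl ?_
    have : {x | ∃ i, R i x} = ⋃ i, {x | R i x} := by ext; simp
    have h2 := MeasurableSet.iUnion hRm
    rw [← this] at h2
    exact h2
  have hP : ∀ x, ∃ j, P j x := by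
    intro x
    by_cases h : ∃ i, R i x
    · obtain ⟨i, hi⟩ := h; exact ⟨i, Or.inr hi⟩
    · exact ⟨0, Or.inl h⟩
  classical
  refine ⟨fun x => T (Nat.find (hP x)) x, Measurable.find hT hPm hP, ?_⟩
  intro x hx
  rcases Nat.find_spec (hP x) with h | h
  · exact (h hx).elim
  · exact ⟨_, h, rfl⟩

theorem sel (Q : Measure E) [IsFiniteMeasure Q] {ε : ℝ} (hε : 0 ≤ ε) {f : E → EReal}
    (hf : Measurable f) (hfbot : ∀ x, f x ≠ ⊥) (φ : EReal → EReal) (hφ : Measurable φ)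
    (hφ2 : ∀ y, y ≠ ⊥ → φ y < y) :
    ∃ T : E → E, Measurable T ∧ ∀ᵐ x ∂Q, dist x (T x) ≤ ε ∧ φ (SS ε f x) < f (T x) := by
  have hA : ∀ q : ℚ, MeasurableSet {x | ((q:ℝ):EReal) < f x} :=
    fun q => measurableSet_lt measurable_const hf
  choose K hKA hKc hK0 using fun q => nbd_ae Q hε (hA q)
  choose T hTm hT using fun (q : ℚ) (n : ℕ) => sel_compact hε (hKc q n)
  obtain ⟨e, he⟩ := exists_surjective_nat (ℚ × ℕ)
  obtain ⟨F', hF'm, hF'⟩ := SS_aem Q hε hf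
  obtain ⟨T', hT'm, hT'⟩ := meas_choice
    (fun j x => dist x (T (e j).1 (e j).2 x) ≤ ε ∧ φ (F' x) < f (T (e j).1 (e j).2 x))
    (fun j => (measurableSet_le (measurable_id.dist (hTm _ _)) measurable_const).inter
      (measurableSet_lt (hφ.comp hF'm) (hf.comp (hTm _ _))))
    (fun j => T (e j).1 (e j).2) (fun j => hTm _ _)
  refine ⟨T', hT'm, ?_⟩
  have hae : ∀ᵐ x ∂Q, ∀ q : ℚ, x ∉ nbd ε {x | ((q:ℝ):EReal) < f x} \ ⋃ n, nbd ε (K q n) :=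
    ae_all_iff.2 fun q => measure_eq_zero_iff_ae_notMem.1 (hK0 q)
  filter_upwards [hF', hae] with x hx hx2
  rw [hx]
  have hne : SS ε f x ≠ ⊥ := by
    intro h
    have := le_SS (f := f) (x := x) (y := x) (by simpa using hε)
    rw [h, le_bot_iff] at this
    exact hfbot x this
  obtain ⟨q, hq1, hq2⟩ := EReal.lt_iff_exists_rat_btwn.1 (hφ2 _ hne)
  have hmem : x ∈ nbd ε {x | ((q:ℝ):EReal) < f x} := by
    rw [← lt_SS]; exact hq2
  have := hx2 q
  rw [Set.mem_sdiff] at this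
  have h3 : x ∈ ⋃ n, nbd ε (K q n) := by
    by_contra h; exact this ⟨hmem, h⟩
  obtain ⟨n, hn⟩ := mem_iUnion.1 h3
  obtain ⟨j, hj⟩ := he (q, n)
  obtain ⟨i, hi, hi2⟩ := hT' x ⟨j, by
    rw [hj]
    refine ⟨(hT q n x hn).2, ?_⟩
    rw [← hx]
    exact hq1.trans (hKA q n (hT q n x hn).1)⟩
  rw [hi2]
  exact hi

/-- approximation from below -/
noncomputable def phi (n : ℕ) (y : EReal) : EReal :=
  if y = ⊤ then ((n : ℝ) : EReal) else ((y.toReal - 1 / ((n : ℝ) + 1) : ℝ) : EReal)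

theorem phi_meas (n : ℕ) : Measurable (phi n) := by
  unfold phi
  refine Measurable.ite (measurableSet_singleton _) measurable_const ?_
  exact (measurable_ereal_toReal.sub_const _).coe_real_ereal

theorem phi_coe (n : ℕ) (r : ℝ) : phi n (r : EReal) = ((r - 1 / ((n : ℝ) + 1) : ℝ) : EReal) := by
  simp [phi]

theorem phi_lt (n : ℕ) (y : EReal) (hy : y ≠ ⊥) : phi n y < y := by
  induction y with
  | bot => exact (hy rfl).elim
  | top => simpa [phi] using EReal.coe_lt_top (n : ℝ)
  | coe r =>
    rw [phi_coe, EReal.coe_lt_coe_iff]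
    have : 0 < 1 / ((n : ℝ) + 1) := by positivity
    linarith

theorem phi_tendsto (y : EReal) (hy : y ≠ ⊥) : Tendsto (fun n => phi n y) atTop (𝓝 y) := by
  induction y with
  | bot => exact (hy rfl).elim
  | top =>
    have : (fun n => phi n ⊤) = fun n : ℕ => ((n : ℝ) : EReal) := by ext; simp [phi]
    rw [this]
    exact EReal.tendsto_coe_nhds_top_iff.2 tendsto_natCast_atTop_atTop
  | coe r =>
    simp_rw [phi_coe]
    refine EReal.tendsto_coe.2 ?_
    simpa using (tendsto_one_div_add_atTop_nhds_zero_nat (𝕜 := ℝ)).const_sub r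

theorem neg_bound (n : ℕ) (y z : EReal) (hy : y ≠ ⊥) (h : phi n y < z) :
    (-z).toENNReal ≤ (-y).toENNReal + ENNReal.ofReal (1 / ((n : ℝ) + 1)) := by
  induction y with
  | bot => exact (hy rfl).elim
  | top =>
    have h0 : (0 : EReal) ≤ z := by
      refine le_trans ?_ h.le
      simp [phi]
    rw [EReal.toENNReal_of_nonpos (by simpa using h0)]
    exact zero_le
  | coe r =>
    rw [phi_coe] at h
    have h2 : -z ≤ ((-r + 1 / ((n : ℝ) + 1) : ℝ) : EReal) := by
      rw [EReal.neg_le, ← EReal.coe_neg]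
      refine le_trans (le_of_eq ?_) h.le
      congr 1; ring
    refine (EReal.toENNReal_le_toENNReal h2).trans ?_
    rw [EReal.real_coe_toENNReal, ← EReal.coe_neg, EReal.real_coe_toENNReal]
    exact ENNReal.ofReal_add_le

theorem winf_map (Q : Measure E) {ε : ℝ} (T : E → E) (hT : Measurable T)
    (h : ∀ᵐ x ∂Q, dist x (T x) ≤ ε) : Winf Q (Q.map T) ≤ ENNReal.ofReal ε := by
  have hm : Measurable (fun x => (x, T x)) := measurable_id.prodMk hT
  refine iInf₂_le_of_le (Q.map (fun x => (x, T x))) ⟨?_, ?_⟩ ?_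
  · rw [Measure.map_map measurable_fst hm]; exact Measure.map_id
  · rw [Measure.map_map measurable_snd hm]; rfl
  · refine essSup_le_of_ae_le _ ?_
    have hms : MeasurableSet {p : E × E | (‖p.1 - p.2‖₊ : ℝ≥0∞) ≤ ENNReal.ofReal ε} :=
      measurableSet_le (by fun_prop) measurable_const
    refine (ae_map_iff hm.aemeasurable hms).2 ?_
    filter_upwards [h] with x hx
    rw [← enorm_eq_nnnorm, ← ofReal_norm]
    rw [dist_eq_norm] at hx
    exact ENNReal.ofReal_le_ofReal hx

theorem ge_dir (Q : Measure E) [IsFiniteMeasure Q] {ε : ℝ} (hε : 0 ≤ ε)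
    {f : E → EReal} (hf : Measurable f) (hfbot : ∀ x, f x ≠ ⊥) (S : EReal)
    (hS : ∀ Q' : Measure E, Winf Q Q' ≤ ENNReal.ofReal ε → erealIntegral Q' f ≤ S) :
    erealIntegral Q (SS ε f) ≤ S := by
  have hF := SS_aem Q hε hf
  have hne : ∀ x, SS ε f x ≠ ⊥ := by
    intro x h
    have := le_SS (f := f) (x := x) (y := x) (by simpa using hε)
    rw [h, le_bot_iff] at this
    exact hfbot x this
  choose T hTm hT using fun n => sel Q hε hf hfbot (phi n) (phi_meas n) (phi_lt n)
  set a := ∫⁻ x, (SS ε f x).toENNReal ∂Q with ha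
  set b := ∫⁻ x, (-(SS ε f x)).toENNReal ∂Q with hb
  change (a : EReal) - (b : EReal) ≤ S
  by_cases hbt : b = ⊤
  · rw [hbt]; simp [sub_eq_add_neg]
  let an : ℕ → ℝ≥0∞ := fun n => ∫⁻ x, (f (T n x)).toENNReal ∂Q
  let bn : ℕ → ℝ≥0∞ := fun n => ∫⁻ x, (-(f (T n x))).toENNReal ∂Q
  have habS : ∀ n, (an n : EReal) - (bn n : EReal) ≤ S := by
    intro n
    have := hS _ (winf_map Q (T n) (hTm n) ((hT n).mono fun x hx => hx.1))
    unfold erealIntegral at this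
    rw [lintegral_map (f := fun x => erealToENNReal (f x)) hf.ereal_toENNReal (hTm n),
      lintegral_map (f := fun x => erealToENNReal (-(f x))) hf.neg.ereal_toENNReal (hTm n)] at this
    exact this
  have hbn : ∀ n : ℕ, bn n ≤ b + ENNReal.ofReal (1 / ((n : ℝ) + 1)) * Q univ := by
    intro n
    rw [hb, ← lintegral_const, ← lintegral_add_right _ measurable_const]
    refine lintegral_mono_ae ?_
    filter_upwards [hT n] with x hx
    exact neg_bound n _ _ (hne x) hx.2
  have han : a ≤ liminf an atTop := by
    refine le_trans ?_ (lintegral_liminf_le (fun n => (hf.comp (hTm n)).ereal_toENNReal))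
    refine lintegral_mono_ae ?_
    filter_upwards [ae_all_iff.2 hT] with x hx
    have ht : Tendsto (fun n => (phi n (SS ε f x)).toENNReal) atTop (𝓝 (SS ε f x).toENNReal) :=
      (EReal.continuous_toENNReal.tendsto _).comp (phi_tendsto _ (hne x))
    rw [← ht.liminf_eq]
    refine liminf_le_liminf (Eventually.of_forall fun n => ?_)
    exact EReal.toENNReal_le_toENNReal (hx n).2.le
  by_contra! hlt
  obtain ⟨s, hs1, hs2⟩ := EReal.lt_iff_exists_real_btwn.1 hlt
  set β := b.toReal with hβ
  have hbβ : (b : EReal) = ((β : ℝ) : EReal) := by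
    rw [hβ, EReal.coe_ennreal_toReal hbt]
  set κ := (Q univ).toReal with hκ
  have h1 : ∀ n : ℕ, an n ≤ ENNReal.ofReal (s + (β + 1 / ((n : ℝ) + 1) * κ)) ∧
      0 ≤ s + (β + 1 / ((n : ℝ) + 1) * κ) := by
    intro n
    have hbn' : (bn n : EReal) ≤ ((β + 1 / ((n : ℝ) + 1) * κ : ℝ) : EReal) := by
      refine (EReal.coe_ennreal_le_coe_ennreal_iff.2 (hbn n)).trans (le_of_eq ?_)
      have hp : 0 ≤ 1 / ((n : ℝ) + 1) := by positivity
      rw [EReal.coe_ennreal_add, EReal.coe_ennreal_mul, hbβ, EReal.coe_add, EReal.coe_mul, hκ,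
        EReal.coe_ennreal_toReal (measure_ne_top _ _), EReal.coe_ennreal_ofReal, max_eq_left hp]
    have h2 : (an n : EReal) - ((β + 1 / ((n : ℝ) + 1) * κ : ℝ) : EReal) ≤ (s : EReal) :=
      (EReal.sub_le_sub le_rfl hbn').trans ((habS n).trans hs1.le)
    rw [EReal.sub_le_iff_le_add (Or.inl (EReal.coe_ne_bot _)) (Or.inl (EReal.coe_ne_top _)),
      ← EReal.coe_add] at h2
    have h3 := EReal.toENNReal_le_toENNReal h2
    rw [EReal.toENNReal_coe, EReal.real_coe_toENNReal] at h3
    exact ⟨h3, EReal.coe_nonneg.1 ((EReal.coe_ennreal_nonneg _).trans h2)⟩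
  have hlim : Tendsto (fun n : ℕ => s + (β + 1 / ((n : ℝ) + 1) * κ)) atTop (𝓝 (s + β)) := by
    have := (((tendsto_one_div_add_atTop_nhds_zero_nat (𝕜 := ℝ)).mul_const κ).const_add β).const_add s
    simpa using this
  have h4 : a ≤ ENNReal.ofReal (s + β) := by
    refine han.trans ?_
    rw [← (ENNReal.tendsto_ofReal hlim).liminf_eq]
    exact liminf_le_liminf (Eventually.of_forall fun n => (h1 n).1)
  have h5 : 0 ≤ s + β := by
    refine ge_of_tendsto' hlim fun n => (h1 n).2
  have h6 := EReal.coe_ennreal_le_coe_ennreal_iff.2 h4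
  rw [EReal.coe_ennreal_ofReal, max_eq_left h5, EReal.coe_add] at h6
  rw [hbβ] at hs2
  have h7 : (a : EReal) - (β : EReal) ≤ s := by
    rwa [EReal.sub_le_iff_le_add (Or.inl (EReal.coe_ne_bot _)) (Or.inl (EReal.coe_ne_top _))]
  exact absurd hs2 (not_lt.2 h7)

end aux2

/-- For a finite Borel measure `Q` and Borel `f : ℝ^d → ℝ ∪ {∞}`,
`∫ S_ε(f) dQ = sup { ∫ f dQ' : W_∞(Q,Q') ≤ ε }`. -/
theorem stmt_5 {E : Type*} [NormedAddCommGroup E] [NormedSpace ℝ E] [FiniteDimensional ℝ E]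
    [MeasurableSpace E] [BorelSpace E]
    (Q : Measure E) [IsFiniteMeasure Q] (f : E → EReal) (hf : Measurable f)
    (hfbot : ∀ x, f x ≠ ⊥) (ε : ℝ) (hε : 0 ≤ ε) :
    erealIntegral Q (fun x => ⨆ h ∈ Metric.closedBall (0 : E) ε, f (x + h)) =
      ⨆ (Q' : Measure E) (_ : Winf Q Q' ≤ ENNReal.ofReal ε), erealIntegral Q' f := by
  have : ProperSpace E := FiniteDimensional.proper ℝ E
  refine le_antisymm ?_ ?_
  · exact ge_dir Q hε hf hfbot _ fun Q' h => le_iSup₂_of_le Q' h le_rfl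
  · exact iSup₂_le fun Q' h => le_dir Q Q' hε hf h
end

section
/- Let ℙ, ℚ be finite positive Borel measures on ℝ^d with ℙ(ℝ^d) = ℚ(ℝ^d). Then W_∞(ℙ, ℚ) = inf{ε ≥ 0 : ∫ h dℚ ≤ ∫ S_ε(h) dℙ for all bounded continuous h : ℝ^d → ℝ}. -/
open MeasureTheory
open scoped ENNReal

/-- A continuous cutoff function equal to `1` on the ball of radius `n`. -/
noncomputable def cutFn (X : Type*) [NormedAddCommGroup X] (n : ℕ) :
    BoundedContinuousFunction X ℝ :=
  BoundedContinuousFunction.ofNormedAddCommGroup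
    (fun x => max 0 (min 1 ((n : ℝ) + 1 - ‖x‖))) (by fun_prop) 1 (by
      intro x
      rw [Real.norm_eq_abs, abs_le]
      constructor
      · linarith [le_max_left 0 (min 1 ((n : ℝ) + 1 - ‖x‖))]
      · exact max_le zero_le_one (min_le_left _ _))

theorem cutFn_apply {X : Type*} [NormedAddCommGroup X] (n : ℕ) (x : X) :
    cutFn X n x = max 0 (min 1 ((n : ℝ) + 1 - ‖x‖)) := rfl

theorem cutFn_nonneg {X : Type*} [NormedAddCommGroup X] (n : ℕ) (x : X) :
    0 ≤ cutFn X n x := le_max_left _ _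

theorem cutFn_le_one {X : Type*} [NormedAddCommGroup X] (n : ℕ) (x : X) :
    cutFn X n x ≤ 1 := max_le zero_le_one (min_le_left _ _)

theorem cutFn_eq_one {X : Type*} [NormedAddCommGroup X] (n : ℕ) (x : X) (hx : ‖x‖ ≤ n) :
    cutFn X n x = 1 := by
  rw [cutFn_apply, min_eq_left (by linarith), max_eq_right zero_le_one]

theorem cutFn_eq_zero {X : Type*} [NormedAddCommGroup X] (n : ℕ) (x : X) (hx : (n : ℝ) + 1 ≤ ‖x‖) :
    cutFn X n x = 0 := by
  rw [cutFn_apply]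
  exact max_eq_left ((min_le_right _ _).trans (by linarith))

theorem cutFn_eventually {X : Type*} [NormedAddCommGroup X] (x : X) :
    ∀ᶠ n : ℕ in Filter.atTop, cutFn X n x = 1 := by
  obtain ⟨N, hN⟩ := exists_nat_ge ‖x‖
  filter_upwards [Filter.eventually_ge_atTop N] with n hn
  exact cutFn_eq_one n x (hN.trans (by exact_mod_cast hn))

theorem cutFn_tendsto {X : Type*} [NormedAddCommGroup X] (x : X) :
    Filter.Tendsto (fun n : ℕ => cutFn X n x) Filter.atTop (nhds 1) :=
  tendsto_const_nhds.congr' ((cutFn_eventually x).mono fun _ h => h.symm)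

open scoped BoundedContinuousFunction in
open Filter Topology in
theorem exists_repr {X : Type*} [NormedAddCommGroup X] [ProperSpace X] [MeasurableSpace X]
    [BorelSpace X] (L : (X →ᵇ ℝ) →ₗ[ℝ] ℝ) (hpos : ∀ F : X →ᵇ ℝ, (∀ x, 0 ≤ F x) → 0 ≤ L F)
    (htight : Tendsto (fun n => L (1 - cutFn X n)) atTop (𝓝 0)) :
    ∃ γ : Measure X, IsFiniteMeasure γ ∧ ∀ F : X →ᵇ ℝ, ∫ x, F x ∂γ = L F := by
  have hmono : ∀ F G : X →ᵇ ℝ, (∀ x, F x ≤ G x) → L F ≤ L G := by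
    intro F G h
    have := hpos (G - F) (fun x => by simpa using h x)
    rw [map_sub] at this
    linarith
  let Lc : CompactlySupportedContinuousMap X ℝ →ₗ[ℝ] ℝ :=
    { toFun := fun f => L f.toBoundedContinuousFunction
      map_add' := fun f g => by
        rw [← map_add]; congr 1
      map_smul' := fun c f => by
        rw [← map_smul]; congr 1 }
  let Lp : CompactlySupportedContinuousMap X ℝ →ₚ[ℝ] ℝ :=
    PositiveLinearMap.mk₀ Lc (fun f hf => hpos _ (fun x => hf x))
  have hcut : ∀ (F : X →ᵇ ℝ) (n : ℕ), HasCompactSupport (⇑(F * cutFn X n)) := by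
    intro F n
    refine HasCompactSupport.intro (isCompact_closedBall (0 : X) ((n : ℝ) + 1)) ?_
    intro x hx
    rw [mem_closedBall_zero_iff, not_le] at hx
    simp [cutFn_eq_zero n x hx.le]
  let C : (X →ᵇ ℝ) → ℕ → CompactlySupportedContinuousMap X ℝ := fun F n =>
    ⟨(F * cutFn X n).toContinuousMap, hcut F n⟩
  have hC : ∀ F n, Lp (C F n) = L (F * cutFn X n) := by
    intro F n
    change L _ = L _
    congr 1
  let γ := RealRMK.rieszMeasure Lp
  have hint : ∀ F n, ∫ x, F x * cutFn X n x ∂γ = L (F * cutFn X n) := by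
    intro F n
    rw [← hC]
    exact RealRMK.integral_rieszMeasure Lp (C F n)
  have hfin : IsFiniteMeasure γ := by
    constructor
    have h1 : ∀ n : ℕ, γ (Metric.closedBall (0 : X) n) ≤ ENNReal.ofReal (L 1) := by
      intro n
      have h2 := RealRMK.rieszMeasure_le_of_eq_one Lp (f := C 1 n)
        (fun x => by
          change 0 ≤ (1 : ℝ) * cutFn X n x
          rw [one_mul]; exact cutFn_nonneg n x)
        (isCompact_closedBall (0 : X) (n : ℝ))
        (fun x hx => by
          change (1 : ℝ) * cutFn X n x = 1
          rw [one_mul]; exact cutFn_eq_one n x (by simpa using hx))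
      refine h2.trans (ENNReal.ofReal_le_ofReal ?_)
      rw [hC, one_mul]
      exact hmono _ _ (fun x => by simpa using cutFn_le_one n x)
    have hU : (⋃ n : ℕ, Metric.closedBall (0 : X) (n : ℝ)) = Set.univ :=
      Metric.iUnion_closedBall_nat 0
    have hM : Monotone (fun n : ℕ => Metric.closedBall (0 : X) (n : ℝ)) := by
      intro a b hab
      exact Metric.closedBall_subset_closedBall (by exact_mod_cast hab)
    rw [← hU, hM.measure_iUnion]
    exact (iSup_le h1).trans_lt ENNReal.ofReal_lt_top
  refine ⟨γ, hfin, fun F => ?_⟩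
  have t1 : Tendsto (fun n : ℕ => ∫ x, F x * cutFn X n x ∂γ) atTop (𝓝 (∫ x, F x ∂γ)) := by
    refine tendsto_integral_of_dominated_convergence (fun _ => ‖F‖) ?_ (integrable_const _) ?_ ?_
    · intro n
      exact ((F * cutFn X n).continuous).aestronglyMeasurable
    · intro n
      refine Eventually.of_forall fun x => ?_
      rw [norm_mul]
      have h1 := F.norm_coe_le_norm x
      have h2 : ‖cutFn X n x‖ ≤ 1 := by
        rw [Real.norm_of_nonneg (cutFn_nonneg n x)]; exact cutFn_le_one n x
      nlinarith [norm_nonneg (F x), norm_nonneg (cutFn X n x)]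
    · refine Eventually.of_forall fun x => ?_
      simpa using (cutFn_tendsto x).const_mul (F x)
  have t2 : Tendsto (fun n : ℕ => L (F * cutFn X n)) atTop (𝓝 (L F)) := by
    rw [tendsto_iff_norm_sub_tendsto_zero]
    have hb : Tendsto (fun n => ‖F‖ * L (1 - cutFn X n)) atTop (𝓝 0) := by
      simpa using htight.const_mul ‖F‖
    refine squeeze_zero (fun _ => norm_nonneg _) (fun n => ?_) hb
    rw [Real.norm_eq_abs, abs_le]
    have e : ‖F‖ * L (1 - cutFn X n) = L (‖F‖ • (1 - cutFn X n)) := by simp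
    rw [e, ← map_sub, ← map_neg]
    have key : ∀ x, |F x * cutFn X n x - F x| ≤ ‖F‖ * (1 - cutFn X n x) := by
      intro x
      have h1 := F.norm_coe_le_norm x
      have : F x * cutFn X n x - F x = - (F x * (1 - cutFn X n x)) := by ring
      rw [this, abs_neg, abs_mul, abs_of_nonneg (sub_nonneg.2 (cutFn_le_one n x))]
      exact mul_le_mul_of_nonneg_right h1 (sub_nonneg.2 (cutFn_le_one n x))
    constructor
    · exact hmono _ _ (fun x => by simpa using (abs_le.1 (key x)).1)
    · exact hmono _ _ (fun x => by simpa using (abs_le.1 (key x)).2)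
  exact tendsto_nhds_unique (by simpa only [hint] using t1) t2

open scoped BoundedContinuousFunction in
theorem exists_functional {E : Type*} [NormedAddCommGroup E] [MeasurableSpace E] [BorelSpace E]
    (P Q : Measure E) [IsFiniteMeasure P] [IsFiniteMeasure Q]
    (hmass : P Set.univ = Q Set.univ) (ε : ℝ) (hε : 0 ≤ ε)
    (H : ∀ h : BoundedContinuousFunction E ℝ,
        (∫ x, h x ∂Q) ≤ ∫ x, ⨆ y ∈ Metric.closedBall x ε, h y ∂P) :
    ∃ L : (E × E →ᵇ ℝ) →ₗ[ℝ] ℝ,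
      (∀ F : E × E →ᵇ ℝ, (∀ x y, dist y x ≤ ε → 0 ≤ F (x, y)) → 0 ≤ L F) ∧
      ∀ f g : E →ᵇ ℝ, L (f.compContinuous ⟨Prod.fst, continuous_fst⟩ +
        g.compContinuous ⟨Prod.snd, continuous_snd⟩) = ∫ x, f x ∂P + ∫ y, g y ∂Q := by
  let T : ((E →ᵇ ℝ) × (E →ᵇ ℝ)) →ₗ[ℝ] (E × E →ᵇ ℝ) :=
    { toFun := fun p => p.1.compContinuous ⟨Prod.fst, continuous_fst⟩ +
        p.2.compContinuous ⟨Prod.snd, continuous_snd⟩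
      map_add' := fun p q => by ext z; simp; ring
      map_smul' := fun c p => by ext z; simp }
  have hT : ∀ p x y, T p (x, y) = p.1 x + p.2 y := fun p x y => rfl
  let I : ((E →ᵇ ℝ) × (E →ᵇ ℝ)) →ₗ[ℝ] ℝ :=
    { toFun := fun p => ∫ x, p.1 x ∂P + ∫ y, p.2 y ∂Q
      map_add' := fun p q => by
        simp only [Prod.fst_add, Prod.snd_add, BoundedContinuousFunction.coe_add, Pi.add_apply]
        rw [integral_add (p.1.integrable P) (q.1.integrable P),
          integral_add (p.2.integrable Q) (q.2.integrable Q)]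
        ring
      map_smul' := fun c p => by
        simp [integral_const_mul]; ring }
  have hI : ∀ p, I p = ∫ x, p.1 x ∂P + ∫ y, p.2 y ∂Q := fun p => rfl
  have hreal : P.real Set.univ = Q.real Set.univ := by simp [Measure.real, hmass]
  have posI : ∀ p, (∀ x y, dist y x ≤ ε → 0 ≤ T p (x, y)) → 0 ≤ I p := by
    rintro ⟨f, g⟩ hp
    simp only [hT] at hp
    have h1 := H (BoundedContinuousFunction.const E ‖g‖ - g)
    have hg : ∀ y, g y ≤ ‖g‖ := fun y => (le_abs_self _).trans (g.norm_coe_le_norm y)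
    have h2 : ∀ x, (⨆ y ∈ Metric.closedBall x ε,
        (BoundedContinuousFunction.const E ‖g‖ - g) y) ≤ ‖g‖ + f x := by
      intro x
      have h0 : 0 ≤ ‖g‖ + f x := by
        have := hp x x (by simpa using hε)
        linarith [hg x]
      refine Real.iSup_le (fun y => Real.iSup_le (fun hy => ?_) h0) h0
      have := hp x y (by simpa using hy)
      simp
      linarith
    have h3 : ∫ x, ⨆ y ∈ Metric.closedBall x ε,
        (BoundedContinuousFunction.const E ‖g‖ - g) y ∂P ≤ ∫ x, (‖g‖ + f x) ∂P := by
      refine integral_mono_of_nonneg (Filter.Eventually.of_forall fun x => ?_)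
        ((integrable_const _).add (f.integrable P)) (Filter.Eventually.of_forall h2)
      refine Real.iSup_nonneg fun y => Real.iSup_nonneg fun hy => ?_
      simpa using hg y
    have h4 := h1.trans h3
    rw [integral_add (integrable_const _) (f.integrable P)] at h4
    simp only [BoundedContinuousFunction.coe_sub, Pi.sub_apply,
      BoundedContinuousFunction.const_apply] at h4
    rw [integral_sub (integrable_const _) (g.integrable Q)] at h4
    simp only [integral_const, hreal] at h4
    rw [hI]
    simp only
    linarith
  have kerI : ∀ p, T p = 0 → I p = 0 := by
    intro p hp
    have a := posI p (fun x y _ => by rw [hp]; simp)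
    have b := posI (-p) (fun x y _ => by rw [map_neg, hp]; simp)
    rw [map_neg] at b
    linarith
  have hproj : Module.Projective ℝ (LinearMap.range T) :=
    Module.Projective.of_basis (Module.Basis.ofVectorSpace ℝ (LinearMap.range T))
  obtain ⟨s, hs⟩ := LinearMap.exists_rightInverse_of_surjective T.rangeRestrict
    T.range_rangeRestrict
  have hs' : ∀ v : LinearMap.range T, T (s v) = v := fun v =>
    congrArg Subtype.val (LinearMap.congr_fun hs v)
  let K : PointedCone ℝ (E × E →ᵇ ℝ) :=
    { carrier := {F | ∀ x y, dist y x ≤ ε → 0 ≤ F (x, y)}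
      add_mem' := fun {a b} ha hb x y h => add_nonneg (ha x y h) (hb x y h)
      zero_mem' := fun x y h => le_rfl
      smul_mem' := fun c F hF x y h => mul_nonneg c.2 (hF x y h) }
  have hK : ∀ F, F ∈ K ↔ ∀ x y, dist y x ≤ ε → 0 ≤ F (x, y) := fun F => Iff.rfl
  obtain ⟨L, hL1, hL2⟩ := riesz_extension K ⟨LinearMap.range T, I ∘ₗ s⟩
    (by
      rintro ⟨v, hv⟩ hvK
      refine posI _ ?_
      rw [hs']
      exact hvK)
    (by
      intro F
      refine ⟨⟨T (BoundedContinuousFunction.const E ‖F‖, 0), ⟨_, rfl⟩⟩, ?_⟩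
      rw [hK]
      intro x y _
      have := (abs_le.1 (F.norm_coe_le_norm (x, y))).1
      simp only [BoundedContinuousFunction.coe_add, Pi.add_apply, hT,
        BoundedContinuousFunction.const_apply, BoundedContinuousFunction.coe_zero, Pi.zero_apply]
      linarith)
  refine ⟨L, fun F hF => hL2 F hF, fun f g => ?_⟩
  have h1 := hL1 ⟨T (f, g), ⟨_, rfl⟩⟩
  have h2 : I (s ⟨T (f, g), ⟨_, rfl⟩⟩) = I (f, g) := by
    have := kerI (s ⟨T (f, g), ⟨_, rfl⟩⟩ - (f, g)) (by rw [map_sub, hs', sub_self])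
    rw [map_sub] at this
    linarith
  exact h1.trans h2

open scoped BoundedContinuousFunction in
open Filter Topology in
theorem exists_coupling {E : Type*} [NormedAddCommGroup E] [ProperSpace E]
    [MeasurableSpace E] [BorelSpace E]
    (P Q : Measure E) [IsFiniteMeasure P] [IsFiniteMeasure Q]
    (hmass : P Set.univ = Q Set.univ) (ε : ℝ) (hε : 0 ≤ ε)
    (H : ∀ h : BoundedContinuousFunction E ℝ,
        (∫ x, h x ∂Q) ≤ ∫ x, ⨆ y ∈ Metric.closedBall x ε, h y ∂P) :
    ∃ γ : Measure (E × E), (γ.map Prod.fst = P ∧ γ.map Prod.snd = Q) ∧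
      ∀ᵐ p ∂γ, ‖p.1 - p.2‖ ≤ ε := by
  obtain ⟨L, hpos, hL⟩ := exists_functional P Q hmass ε hε H
  have hcutlim : ∀ (μ : Measure E) [IsFiniteMeasure μ],
      Tendsto (fun n : ℕ => ∫ x, (1 - cutFn E n) x ∂μ) atTop (𝓝 0) := by
    intro μ _
    have : Tendsto (fun n : ℕ => ∫ x, (1 - cutFn E n) x ∂μ) atTop (𝓝 (∫ x, (0 : ℝ) ∂μ)) := by
      refine tendsto_integral_of_dominated_convergence (fun _ => 1) ?_ (integrable_const _) ?_ ?_
      · intro n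
        exact ((1 - cutFn E n).continuous).aestronglyMeasurable
      · intro n
        refine Eventually.of_forall fun x => ?_
        have h1 := cutFn_nonneg n x
        have h2 := cutFn_le_one n x
        simp only [BoundedContinuousFunction.coe_sub, Pi.sub_apply,
          BoundedContinuousFunction.coe_one, Pi.one_apply]
        rw [Real.norm_eq_abs, abs_le]
        constructor <;> linarith
      · refine Eventually.of_forall fun x => ?_
        simpa using (cutFn_tendsto x).const_sub 1
    simpa using this
  have hmono : ∀ F G : E × E →ᵇ ℝ, (∀ x, F x ≤ G x) → L F ≤ L G := by
    intro F G h
    have := hpos (G - F) (fun x y _ => by simpa using h (x, y))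
    rw [map_sub] at this
    linarith
  have htight : Tendsto (fun n => L (1 - cutFn (E × E) n)) atTop (𝓝 0) := by
    have hb : Tendsto (fun n : ℕ => ∫ x, (1 - cutFn E n) x ∂P + ∫ x, (1 - cutFn E n) x ∂Q)
        atTop (𝓝 0) := by simpa using (hcutlim P).add (hcutlim Q)
    refine squeeze_zero (fun n => hpos _ fun x y _ => ?_) (fun n => ?_) hb
    · simpa using cutFn_le_one n (x, y)
    · rw [← hL]
      refine hmono _ _ ?_
      rintro ⟨x, y⟩
      change 1 - cutFn (E × E) n (x, y) ≤ (1 - cutFn E n x) + (1 - cutFn E n y)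
      have hx := cutFn_le_one n x
      have hy := cutFn_le_one n y
      rcases le_total ‖x‖ ‖y‖ with h | h
      · have : cutFn (E × E) n (x, y) = cutFn E n y := by
          rw [cutFn_apply, cutFn_apply, Prod.norm_mk, max_eq_right h]
        linarith
      · have : cutFn (E × E) n (x, y) = cutFn E n x := by
          rw [cutFn_apply, cutFn_apply, Prod.norm_mk, max_eq_left h]
        linarith
  obtain ⟨γ, hfin, hγ⟩ := exists_repr L (fun F h => hpos F fun x y _ => h (x, y)) htight
  refine ⟨γ, ⟨?_, ?_⟩, ?_⟩
  · refine ext_of_forall_integral_eq_of_IsFiniteMeasure fun f => ?_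
    rw [integral_map measurable_fst.aemeasurable f.continuous.aestronglyMeasurable]
    have := hL f 0
    rw [← hγ] at this
    simpa using this
  · refine ext_of_forall_integral_eq_of_IsFiniteMeasure fun f => ?_
    rw [integral_map measurable_snd.aemeasurable f.continuous.aestronglyMeasurable]
    have := hL 0 f
    rw [← hγ] at this
    simpa using this
  · let F : E × E →ᵇ ℝ := BoundedContinuousFunction.ofNormedAddCommGroup
      (fun p => max 0 (min 1 (‖p.1 - p.2‖ - ε))) (by fun_prop) 1 (by
        intro x
        rw [Real.norm_of_nonneg (le_max_left _ _)]
        exact max_le zero_le_one (min_le_left _ _))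
    have hF : ∀ p, F p = max 0 (min 1 (‖p.1 - p.2‖ - ε)) := fun p => rfl
    have hF0 : ∀ x y, dist y x ≤ ε → F (x, y) = 0 := by
      intro x y h
      rw [hF]
      rw [dist_comm, dist_eq_norm] at h
      exact max_eq_left ((min_le_right _ _).trans (by simpa using h))
    have h1 : ∫ p, F p ∂γ = 0 := by
      rw [hγ]
      have a := hpos F (fun x y h => (hF0 x y h).ge)
      have b := hpos (-F) (fun x y h => by simp [hF0 x y h])
      rw [map_neg] at b
      linarith
    rw [integral_eq_zero_iff_of_nonneg (f := ⇑F) (fun p => le_max_left _ _) (F.integrable γ)] at h1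
    filter_upwards [h1] with p hp
    by_contra hcon
    have : 0 < F p := by
      rw [hF]
      exact lt_max_of_lt_right (lt_min one_pos (by linarith))
    exact this.ne' hp

theorem supFn_le {E : Type*} [NormedAddCommGroup E] (h : BoundedContinuousFunction E ℝ)
    (ε : ℝ) (x : E) : (⨆ y ∈ Metric.closedBall x ε, h y) ≤ ‖h‖ :=
  Real.iSup_le (fun y => Real.iSup_le
    (fun _ => (le_abs_self _).trans (h.norm_coe_le_norm y)) (norm_nonneg _)) (norm_nonneg _)

theorem le_supFn {E : Type*} [NormedAddCommGroup E] (h : BoundedContinuousFunction E ℝ)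
    (ε : ℝ) (x y : E) (hy : y ∈ Metric.closedBall x ε) :
    h y ≤ ⨆ y ∈ Metric.closedBall x ε, h y := by
  refine le_ciSup_of_le ⟨‖h‖, ?_⟩ y ?_
  · rintro _ ⟨z, rfl⟩
    exact Real.iSup_le (fun _ => (le_abs_self _).trans (h.norm_coe_le_norm z)) (norm_nonneg _)
  · rw [ciSup_pos hy]

theorem supFn_measurable {E : Type*} [NormedAddCommGroup E] [NormedSpace ℝ E]
    [MeasurableSpace E] [BorelSpace E] (h : BoundedContinuousFunction E ℝ) (ε : ℝ) (hε : 0 ≤ ε) :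
    Measurable (fun x => ⨆ y ∈ Metric.closedBall x ε, h y) := by
  rcases subsingleton_or_nontrivial E with hE | hE
  · have : ∀ x : E, x = 0 := fun x => Subsingleton.elim _ _
    intro s _
    exact Set.Subsingleton.measurableSet (fun a _ b _ => Subsingleton.elim a b)
  · have hle : ∀ y, h y ≤ ‖h‖ := fun y => (le_abs_self _).trans (h.norm_coe_le_norm y)
    have hbdd : ∀ x, BddAbove (Set.range fun u : Metric.closedBall (0 : E) ε => h (x + u)) := by
      rintro x
      refine ⟨‖h‖, ?_⟩
      rintro _ ⟨u, rfl⟩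
      exact hle _
    have hS : Measurable (fun x => ⨆ u : Metric.closedBall (0 : E) ε, h (x + u)) := by
      refine LowerSemicontinuous.measurable (lowerSemicontinuous_ciSup hbdd fun u => ?_)
      exact Continuous.lowerSemicontinuous (by fun_prop)
    have heq : (fun x => ⨆ y ∈ Metric.closedBall x ε, h y) =
        fun x => max (⨆ u : Metric.closedBall (0 : E) ε, h (x + u)) 0 := by
      funext x
      have : Nonempty (Metric.closedBall (0 : E) ε) := ⟨⟨0, by simpa using hε⟩⟩
      apply le_antisymm
      · refine Real.iSup_le (fun y => Real.iSup_le (fun hy => ?_) (le_max_right _ _))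
          (le_max_right _ _)
        refine le_max_of_le_left (le_ciSup_of_le (hbdd x) ⟨y - x, ?_⟩ ?_)
        · simpa [dist_eq_norm] using hy
        · simp
      · refine max_le (ciSup_le fun u => le_supFn h ε x _ ?_) ?_
        · have hu := u.2
          rw [mem_closedBall_zero_iff] at hu
          simpa [dist_eq_norm] using hu
        · obtain ⟨z, hz⟩ := NormedSpace.exists_lt_norm ℝ E ε
          refine le_ciSup_of_le ⟨‖h‖, ?_⟩ (x + z) ?_
          · rintro _ ⟨z, rfl⟩
            exact Real.iSup_le (fun _ => hle z) (norm_nonneg _)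
          · have : ¬ (x + z ∈ Metric.closedBall x ε) := by
              simpa [dist_eq_norm] using hz
            have : IsEmpty (x + z ∈ Metric.closedBall x ε) := ⟨this⟩
            rw [Real.iSup_of_isEmpty]
    rw [heq]
    exact hS.max measurable_const

theorem coupling_ineq {E : Type*} [NormedAddCommGroup E] [NormedSpace ℝ E]
    [MeasurableSpace E] [BorelSpace E]
    (P Q : Measure E) [IsFiniteMeasure P] [IsFiniteMeasure Q] (γ : Measure (E × E))
    (h1 : γ.map Prod.fst = P) (h2 : γ.map Prod.snd = Q) (ε : ℝ) (hε : 0 ≤ ε)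
    (hγ : ∀ᵐ p ∂γ, ‖p.1 - p.2‖ ≤ ε) (h : BoundedContinuousFunction E ℝ) :
    (∫ x, h x ∂Q) ≤ ∫ x, ⨆ y ∈ Metric.closedBall x ε, h y ∂P := by
  have hm := supFn_measurable h ε hε
  have hint : Integrable (fun x => ⨆ y ∈ Metric.closedBall x ε, h y) P := by
    refine Integrable.of_bound hm.aestronglyMeasurable ‖h‖ (Filter.Eventually.of_forall fun x => ?_)
    rw [Real.norm_eq_abs, abs_le]
    refine ⟨?_, supFn_le h ε x⟩
    exact (abs_le.1 (h.norm_coe_le_norm x)).1.trans (le_supFn h ε x x (by simpa using hε))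
  have hiQ := h.integrable Q
  subst h1 h2
  rw [integral_map measurable_fst.aemeasurable hint.aestronglyMeasurable,
    integral_map measurable_snd.aemeasurable hiQ.aestronglyMeasurable]
  refine integral_mono_ae (hiQ.comp_measurable measurable_snd)
    (hint.comp_measurable measurable_fst) ?_
  filter_upwards [hγ] with p hp
  refine le_supFn h ε p.1 p.2 ?_
  rwa [Metric.mem_closedBall, dist_comm, dist_eq_norm]

theorem stmt_6 {E : Type*} [NormedAddCommGroup E] [NormedSpace ℝ E] [FiniteDimensional ℝ E]
    [MeasurableSpace E] [BorelSpace E]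
    (P Q : Measure E) [IsFiniteMeasure P] [IsFiniteMeasure Q]
    (hmass : P Set.univ = Q Set.univ) :
    Winf P Q = sInf (ENNReal.ofReal ''
      {ε : ℝ | 0 ≤ ε ∧ ∀ h : BoundedContinuousFunction E ℝ,
        (∫ x, h x ∂Q) ≤ ∫ x, ⨆ y ∈ Metric.closedBall x ε, h y ∂P}) := by
  have : ProperSpace E := FiniteDimensional.proper ℝ E
  apply le_antisymm
  · refine le_sInf ?_
    rintro _ ⟨ε, ⟨hε, H⟩, rfl⟩
    obtain ⟨γ, hγ, hae⟩ := exists_coupling P Q hmass ε hε H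
    refine (iInf₂_le γ hγ).trans (essSup_le_of_ae_le _ ?_)
    filter_upwards [hae] with p hp
    change ‖p.1 - p.2‖ₑ ≤ _
    rw [← ofReal_norm]
    exact ENNReal.ofReal_le_ofReal hp
  · refine le_iInf₂ fun γ hγ => ?_
    rcases eq_or_ne (essSup (fun p : E × E => (‖p.1 - p.2‖₊ : ℝ≥0∞)) γ) ∞ with htop | htop
    · rw [htop]; exact le_top
    · rw [← ENNReal.ofReal_toReal htop]
      refine sInf_le ⟨_, ⟨ENNReal.toReal_nonneg, fun h => ?_⟩, rfl⟩
      refine coupling_ineq P Q γ hγ.1 hγ.2 _ ENNReal.toReal_nonneg ?_ h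
      filter_upwards [ENNReal.ae_le_essSup (μ := γ)
        (fun p : E × E => (‖p.1 - p.2‖₊ : ℝ≥0∞))] with p hp
      have := ENNReal.toReal_mono htop hp
      simpa using this
end
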